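/- Let G = ⟨s₁,...,s_r⟩ be the free group of rank r acting on (X,μ), and define F(α) = (1-2r)H(α) + Σ_{i=1}^r H(α ∨ s_iα). If σ is a splitting of α, then F(σ) ≤ F(α). -/

import Mathlib

open MeasureTheory Real
open scoped symmDiff ENNReal

namespace Bowen

variable {X : Type*} [MeasurableSpace X]

/-- Shannon entropy of the (countable) partition of `X` into fibers of `α`. -/
noncomputable def entropy {ι : Type*} (μ : Measure X) (α : X → ι) : ℝ :=
  ∑' i, Real.negMulLog (μ (α ⁻¹' {i})).toReal

/-- Conditional entropy `H(α|β)` of the fiber partition of `α` given that of `β`. -/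
noncomputable def condEntropy {ι κ : Type*} (μ : Measure X) (α : X → ι) (β : X → κ) : ℝ :=
  ∑' p : ι × κ,
    -((μ (α ⁻¹' {p.1} ∩ β ⁻¹' {p.2})).toReal *
      Real.log ((μ (α ⁻¹' {p.1} ∩ β ⁻¹' {p.2})).toReal / (μ (β ⁻¹' {p.2})).toReal))

/-- The Rokhlin distance `d(α,β) = H(α|β) + H(β|α)`. -/
noncomputable def rokhlin {ι κ : Type*} (μ : Measure X) (α : X → ι) (β : X → κ) : ℝ :=
  condEntropy μ α β + condEntropy μ β α

/-- A finite measurable partition, presented as a measurable map to `ℕ` with finite range. -/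
def IsFinPart (α : X → ℕ) : Prop := Measurable α ∧ (Set.range α).Finite

/-- `α` refines `β` (mod null sets): `β` factors a.e. through `α`. -/
def RefinesI {ι κ : Type*} (μ : Measure X) (α : X → ι) (β : X → κ) : Prop :=
  ∃ h : ι → κ, ∀ᵐ x ∂μ, β x = h (α x)

/-- The join `α ∨ β` of two `ℕ`-indexed partitions, encoded via `Nat.pair`. -/
def joinN (α β : X → ℕ) : X → ℕ := fun x => Nat.pair (α x) (β x)

/-- The translated partition `gα`, with atoms `gA = {x | g⁻¹x ∈ A}` for atoms `A` of `α`. -/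
def smulPart {G : Type*} [Group G] [MulAction G X] {ι : Type*} (g : G) (α : X → ι) : X → ι :=
  fun x => α (g⁻¹ • x)

/-- Join of a list of `ℕ`-indexed partitions. -/
def joinList (l : List (X → ℕ)) : X → ℕ :=
  l.foldr (fun a r x => Nat.pair (a x) (r x)) (fun _ => 0)

/-- The join `α^F = ⋁_{g ∈ F} gα` over a finite set of group elements. -/
noncomputable def joinOver {G : Type*} [Group G] [MulAction G X] (F : Finset G) (α : X → ℕ) : X → ℕ :=
  joinList (F.toList.map (fun g => smulPart g α))

/-- The smallest `G`-invariant σ-algebra containing the partition `α`. -/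
def genSA (G : Type*) [Group G] [MulAction G X] {ι : Type*} (α : X → ι) :
    MeasurableSpace X :=
  MeasurableSpace.generateFrom {s | ∃ (g : G) (i : ι), s = {x | α (g⁻¹ • x) = i}}

/-- `α` is a generating partition: every measurable set agrees mod `μ`-null sets with a set
in the smallest `G`-invariant σ-algebra containing `α`. -/
def IsGenerating (G : Type*) [Group G] [MulAction G X] {ι : Type*} (μ : Measure X)
    (α : X → ι) : Prop :=
  ∀ s : Set X, MeasurableSet s → ∃ t : Set X, MeasurableSet[genSA G α] t ∧ μ (s ∆ t) = 0

/-- Combinatorial equivalence: `α ≤ β^L` and `β ≤ α^M` for some finite `L, M ⊆ G`. -/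
def CombEquiv (G : Type*) [Group G] [MulAction G X] (μ : Measure X) (α β : X → ℕ) : Prop :=
  ∃ L M : Finset G, RefinesI μ (joinOver L β) α ∧ RefinesI μ (joinOver M α) β

/-- `α` and `β` induce the same partition mod null sets. -/
def SamePart (μ : Measure X) (α β : X → ℕ) : Prop := RefinesI μ α β ∧ RefinesI μ β α

/-- `σ` is a simple splitting of `α`: `σ = α ∨ sβ` (as partitions, mod null sets) for some
`s ∈ S` and some coarsening `β` of `α`. -/
def SimpleSplit {G : Type*} [Group G] [MulAction G X] (μ : Measure X) (S : Finset G)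
    (σ α : X → ℕ) : Prop :=
  ∃ s ∈ S, ∃ β : X → ℕ, RefinesI μ α β ∧ SamePart μ σ (joinN α (smulPart s β))

/-- `σ` is a splitting of `α`: obtained from `α` by finitely many simple splittings. -/
def IsSplitting {G : Type*} [Group G] [MulAction G X] (μ : Measure X) (S : Finset G)
    (σ α : X → ℕ) : Prop :=
  Relation.ReflTransGen (fun a b => SimpleSplit μ S b a) α σ

/-- The ball of radius `n` about the identity for the word metric of `S`:
all products of at most `n` elements of `S`. -/
def ballF {G : Type*} [Group G] [DecidableEq G] (S : Finset G) : ℕ → Finset G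
  | 0 => {1}
  | n + 1 => ballF S n ∪ (S ×ˢ ballF S n).image (fun p => p.1 * p.2)

/-- The Cayley graph of `(G,S)` (as a simple graph). -/
def cayley {G : Type*} [Group G] (S : Finset G) : SimpleGraph G :=
  SimpleGraph.fromRel (fun g h => g⁻¹ * h ∈ S)

/-- The symmetric generating set `S = {s₁^{±1},...,s_r^{±1}}` of the rank `r` free group. -/
noncomputable def genS (r : ℕ) : Finset (FreeGroup (Fin r)) :=
  letI := Classical.decEq (FreeGroup (Fin r))
  (Finset.univ.image fun i : Fin r => FreeGroup.of i) ∪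
    (Finset.univ.image fun i : Fin r => (FreeGroup.of i)⁻¹)

/-- The word-metric ball of radius `n` about `e` in the rank `r` free group. -/
noncomputable def ballFree (r : ℕ) (n : ℕ) : Finset (FreeGroup (Fin r)) :=
  letI := Classical.decEq (FreeGroup (Fin r))
  ballF (genS r) n

/-- Bowen's functional `F(α) = (1-2r)H(α) + ∑ᵢ H(α ∨ sᵢα)`. -/
noncomputable def Ffun (r : ℕ) {X : Type*} [MeasurableSpace X]
    [MulAction (FreeGroup (Fin r)) X] (μ : Measure X) (α : X → ℕ) : ℝ :=
  (1 - 2 * (r : ℝ)) * entropy μ α +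
    ∑ i : Fin r, entropy μ (joinN α (smulPart (FreeGroup.of i) α))

/-- Conditional entropy of the partition `α` relative to a sub-σ-algebra `m`:
`H(α|m) = ∫ -log μ(A_x|m)(x) dμ(x)`. -/
noncomputable def condEntropySigma (μ : Measure X) (α : X → ℕ) (m : MeasurableSpace X) : ℝ :=
  ∫ x, -Real.log ((μ[Set.indicator (α ⁻¹' {α x}) (fun _ => (1 : ℝ))|m]) x) ∂μ

end Bowen

open Bowen

namespace Bowen

section Pointwise

variable {X : Type*}

lemma smulPart_smulPart {G : Type*} [Group G] [MulAction G X] (s t : G) (f : X → ℕ) :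
    smulPart s (smulPart t f) = smulPart (s * t) f := by
  funext x
  simp [Bowen.smulPart, mul_smul]

lemma smulPart_one {G : Type*} [Group G] [MulAction G X] (f : X → ℕ) :
    smulPart (1 : G) f = f := by
  funext x
  simp [Bowen.smulPart]

lemma eq_sum_indicator_of_mem {ι : Type*} {J : X → ι} {T : Finset ι} (hT : ∀ x, J x ∈ T)
    (φ : ι → ℝ) :
    (fun x => φ (J x)) = fun x => ∑ z ∈ T, (J ⁻¹' {z}).indicator (fun _ => φ z) x := by
  classical
  funext x
  rw [Finset.sum_eq_single_of_mem (J x) (hT x)]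
  · simp
  · intro z _ hz
    exact Set.indicator_of_notMem (fun h => hz (by simpa using h.symm)) _

lemma joinN_preimage_singleton (f g : X → ℕ) (x : X) :
    joinN f g ⁻¹' {joinN f g x} = f ⁻¹' {f x} ∩ g ⁻¹' {g x} := by
  ext y
  simp [joinN, Nat.pair_eq_pair]

end Pointwise

section Refinement

variable {X : Type*} [MeasurableSpace X] {μ : Measure X} {f g k : X → ℕ}

lemma RefinesI.refl (f : X → ℕ) : RefinesI μ f f :=
  ⟨id, Filter.Eventually.of_forall fun _ => rfl⟩

lemma RefinesI.trans (h₁ : RefinesI μ f g) (h₂ : RefinesI μ g k) : RefinesI μ f k := by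
  obtain ⟨a, ha⟩ := h₁
  obtain ⟨b, hb⟩ := h₂
  refine ⟨b ∘ a, ?_⟩
  filter_upwards [ha, hb] with x h1 h2
  simp [h1, h2]

lemma refinesI_joinN_left (f g : X → ℕ) : RefinesI μ (joinN f g) f :=
  ⟨fun n => n.unpair.1, Filter.Eventually.of_forall fun _ => by simp [joinN]⟩

lemma refinesI_joinN_right (f g : X → ℕ) : RefinesI μ (joinN f g) g :=
  ⟨fun n => n.unpair.2, Filter.Eventually.of_forall fun _ => by simp [joinN]⟩

lemma RefinesI.joinN (h₁ : RefinesI μ f g) (h₂ : RefinesI μ f k) :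
    RefinesI μ f (joinN g k) := by
  obtain ⟨a, ha⟩ := h₁
  obtain ⟨b, hb⟩ := h₂
  refine ⟨fun n => Nat.pair (a n) (b n), ?_⟩
  filter_upwards [ha, hb] with x h1 h2
  simp [Bowen.joinN, h1, h2]

lemma RefinesI.smulPart {G : Type*} [Group G] [MulAction G X]
    (hmp : ∀ g : G, MeasurePreserving (fun x : X => g • x) μ μ) (h : RefinesI μ f g) (s : G) :
    RefinesI μ (smulPart s f) (smulPart s g) := by
  obtain ⟨a, ha⟩ := h
  exact ⟨a, (hmp s⁻¹).quasiMeasurePreserving.ae ha⟩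

lemma samePart_joinN_comm (f g : X → ℕ) : SamePart μ (joinN f g) (joinN g f) :=
  ⟨(refinesI_joinN_right f g).joinN (refinesI_joinN_left f g),
    (refinesI_joinN_right g f).joinN (refinesI_joinN_left g f)⟩

end Refinement

section AlmostEverywhereFinite

variable {X : Type*} [MeasurableSpace X] {μ : Measure X} {f g : X → ℕ}

/-- `f` agrees almost everywhere with a finite measurable partition. -/
def IsAEFinPart (μ : Measure X) (f : X → ℕ) : Prop := ∃ f', IsFinPart f' ∧ f =ᵐ[μ] f'

lemma IsFinPart.isAEFinPart (hf : IsFinPart f) : IsAEFinPart μ f :=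
  ⟨f, hf, Filter.EventuallyEq.rfl⟩

lemma IsFinPart.joinN (hf : IsFinPart f) (hg : IsFinPart g) : IsFinPart (joinN f g) := by
  refine ⟨(measurable_of_countable fun p : ℕ × ℕ => Nat.pair p.1 p.2).comp (hf.1.prodMk hg.1),
    (hf.2.image2 Nat.pair hg.2).subset ?_⟩
  rintro _ ⟨x, rfl⟩
  exact Set.mem_image2_of_mem ⟨x, rfl⟩ ⟨x, rfl⟩

lemma IsAEFinPart.of_refinesI (hf : IsAEFinPart μ f) (h : RefinesI μ f g) :
    IsAEFinPart μ g := by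
  obtain ⟨f', hf', hff'⟩ := hf
  obtain ⟨a, ha⟩ := h
  refine ⟨a ∘ f', ⟨(measurable_of_countable a).comp hf'.1, ?_⟩, ?_⟩
  · rw [Set.range_comp]
    exact hf'.2.image a
  · filter_upwards [hff', ha] with x h1 h2
    simp [h2, h1]

lemma joinN_congr_ae {f f' g g' : X → ℕ} (hf : f =ᵐ[μ] f') (hg : g =ᵐ[μ] g') :
    joinN f g =ᵐ[μ] joinN f' g' := by
  filter_upwards [hf, hg] with x h1 h2
  simp [Bowen.joinN, h1, h2]

lemma IsAEFinPart.joinN (hf : IsAEFinPart μ f) (hg : IsAEFinPart μ g) :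
    IsAEFinPart μ (joinN f g) := by
  obtain ⟨f', hf', hff'⟩ := hf
  obtain ⟨g', hg', hgg'⟩ := hg
  exact ⟨_, hf'.joinN hg', joinN_congr_ae hff' hgg'⟩

lemma IsAEFinPart.smulPart {G : Type*} [Group G] [MulAction G X]
    (hmp : ∀ g : G, MeasurePreserving (fun x : X => g • x) μ μ) (hf : IsAEFinPart μ f) (s : G) :
    IsAEFinPart μ (smulPart s f) := by
  obtain ⟨f', hf', hff'⟩ := hf
  refine ⟨Bowen.smulPart s f', ⟨hf'.1.comp (hmp s⁻¹).measurable, hf'.2.subset ?_⟩,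
    (hmp s⁻¹).quasiMeasurePreserving.ae hff'⟩
  rintro _ ⟨x, rfl⟩
  exact ⟨_, rfl⟩

end AlmostEverywhereFinite

section Entropy

variable {X : Type*} [MeasurableSpace X] {μ : Measure X} {f g k : X → ℕ}

lemma preimage_singleton_congr_ae {f f' : X → ℕ} (h : f =ᵐ[μ] f') (i : ℕ) :
    f ⁻¹' {i} =ᵐ[μ] f' ⁻¹' {i} :=
  h.preimage {i}

lemma entropy_congr_ae {f f' : X → ℕ} (h : f =ᵐ[μ] f') : entropy μ f = entropy μ f' := by
  unfold entropy
  congr! 3 with i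
  rw [measure_congr (preimage_singleton_congr_ae h i)]

lemma IsFinPart.measurableSet_preimage (hf : IsFinPart f) (z : ℕ) :
    MeasurableSet (f ⁻¹' {z}) :=
  hf.1 (measurableSet_singleton z)

lemma IsAEFinPart.entropy_smulPart {G : Type*} [Group G] [MulAction G X]
    (hmp : ∀ g : G, MeasurePreserving (fun x : X => g • x) μ μ) (hf : IsAEFinPart μ f) (s : G) :
    entropy μ (Bowen.smulPart s f) = entropy μ f := by
  obtain ⟨f', hf', h⟩ := hf
  have h' : Bowen.smulPart s f =ᵐ[μ] Bowen.smulPart s f' :=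
    (hmp s⁻¹).quasiMeasurePreserving.ae h
  rw [entropy_congr_ae h, entropy_congr_ae h']
  unfold entropy
  congr! 4 with i
  exact (hmp s⁻¹).measure_preimage (hf'.measurableSet_preimage i).nullMeasurableSet

variable [IsProbabilityMeasure μ]

lemma integrable_comp_of_mem_finset {ι : Type*} {J : X → ι} {T : Finset ι} (hT : ∀ x, J x ∈ T)
    (hJ : ∀ z, MeasurableSet (J ⁻¹' {z})) (φ : ι → ℝ) : Integrable (fun x => φ (J x)) μ := by
  rw [eq_sum_indicator_of_mem hT]
  exact integrable_finsetSum _ fun z _ => (integrable_const _).indicator (hJ z)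

lemma integral_comp_of_mem_finset {ι : Type*} {J : X → ι} {T : Finset ι} (hT : ∀ x, J x ∈ T)
    (hJ : ∀ z, MeasurableSet (J ⁻¹' {z})) (φ : ι → ℝ) :
    ∫ x, φ (J x) ∂μ = ∑ z ∈ T, μ.real (J ⁻¹' {z}) * φ z := by
  rw [eq_sum_indicator_of_mem hT,
    integral_finsetSum _ fun z _ => (integrable_const _).indicator (hJ z)]
  refine Finset.sum_congr rfl fun z _ => ?_
  rw [integral_indicator_const _ (hJ z), smul_eq_mul]

lemma IsFinPart.mem_toFinset (hf : IsFinPart f) (x : X) : f x ∈ hf.2.toFinset := by simp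

/-- The entropy is the integral of the information function. -/
lemma IsFinPart.entropy_eq_integral (hf : IsFinPart f) :
    entropy μ f = ∫ x, -log (μ.real (f ⁻¹' {f x})) ∂μ := by
  rw [integral_comp_of_mem_finset hf.mem_toFinset hf.measurableSet_preimage
    fun z => -log (μ.real (f ⁻¹' {z})), entropy, tsum_eq_sum (s := hf.2.toFinset)]
  · refine Finset.sum_congr rfl fun z _ => ?_
    simp [negMulLog, Measure.real]
  · intro z hz
    have : f ⁻¹' {z} = ∅ := by
      rw [Set.preimage_singleton_eq_empty]
      simpa using hz
    simp [this]

lemma IsAEFinPart.entropy_eq_integral (hf : IsAEFinPart μ f) :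
    entropy μ f = ∫ x, -log (μ.real (f ⁻¹' {f x})) ∂μ := by
  obtain ⟨f', hf', h⟩ := hf
  rw [entropy_congr_ae h, hf'.entropy_eq_integral]
  refine integral_congr_ae ?_
  filter_upwards [h] with x hx
  rw [hx, measureReal_congr (preimage_singleton_congr_ae h _)]

lemma IsAEFinPart.entropy_eq (hf : IsAEFinPart μ f) (h : SamePart μ f g) :
    entropy μ f = entropy μ g := by
  rw [hf.entropy_eq_integral, (hf.of_refinesI h.1).entropy_eq_integral]
  obtain ⟨⟨a, ha⟩, ⟨b, hb⟩⟩ := h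
  refine integral_congr_ae ?_
  filter_upwards [ha, hb] with x hax hbx
  congr 2
  refine measureReal_congr ?_
  filter_upwards [ha, hb] with y hay hby
  refine propext ⟨fun h => ?_, fun h => ?_⟩
  · change f y = f x at h
    change g y = g x
    rw [hay, hax, h]
  · change g y = g x at h
    change f y = f x
    rw [hby, hbx, h]

lemma IsFinPart.sum_measureReal_inter (hf : IsFinPart f) (s : Set X) :
    ∑ a ∈ hf.2.toFinset, μ.real (f ⁻¹' {a} ∩ s) = μ.real s := by
  have h := sum_measureReal_preimage_singleton (μ := μ.restrict s) hf.2.toFinset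
    (f := f) fun a _ => hf.measurableSet_preimage a
  have hu : f ⁻¹' (hf.2.toFinset : Set ℕ) = Set.univ := by ext x; simp
  rw [hu, measureReal_restrict_apply_univ] at h
  rw [← h]
  exact Finset.sum_congr rfl fun a _ =>
    (measureReal_restrict_apply (hf.measurableSet_preimage a)).symm

lemma ae_measureReal_preimage_pos (f : X → ℕ) :
    ∀ᵐ x ∂μ, 0 < μ.real (f ⁻¹' {f x}) := by
  have h : ∀ᵐ x ∂μ, ∀ z : ℕ, μ (f ⁻¹' {z}) = 0 → x ∉ f ⁻¹' {z} := by
    rw [ae_all_iff]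
    intro z
    by_cases hz : μ (f ⁻¹' {z}) = 0
    · filter_upwards [measure_eq_zero_iff_ae_notMem.1 hz] with x hx _ using hx
    · exact Filter.Eventually.of_forall fun x h => absurd h hz
  filter_upwards [h] with x hx
  exact ENNReal.toReal_pos (fun h0 => hx _ h0 rfl) (measure_ne_top _ _)

lemma IsFinPart.sum_ratio_le_one (hf : IsFinPart f) (hg : IsFinPart g) (hk : IsFinPart k) :
    ∑ z ∈ hf.2.toFinset ×ˢ hg.2.toFinset ×ˢ hk.2.toFinset,
      μ.real (f ⁻¹' {z.1} ∩ k ⁻¹' {z.2.2}) * μ.real (g ⁻¹' {z.2.1} ∩ k ⁻¹' {z.2.2}) /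
        μ.real (k ⁻¹' {z.2.2}) ≤ 1 := by
  rw [Finset.sum_product]
  simp only [Finset.sum_product_right]
  rw [Finset.sum_comm]
  have hone : ∑ c ∈ hk.2.toFinset, μ.real (k ⁻¹' {c}) = 1 := by
    simpa using hk.sum_measureReal_inter (μ := μ) Set.univ
  rw [← hone]
  refine Finset.sum_le_sum fun c _ => ?_
  simp only [← Finset.sum_div, ← Finset.mul_sum, ← Finset.sum_mul]
  rw [hg.sum_measureReal_inter, hf.sum_measureReal_inter, mul_self_div_self]

lemma IsFinPart.entropy_submodular (hf : IsFinPart f) (hg : IsFinPart g) (hk : IsFinPart k) :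
    entropy μ (Bowen.joinN (Bowen.joinN f g) k) + entropy μ k ≤
      entropy μ (Bowen.joinN f k) + entropy μ (Bowen.joinN g k) := by
  have hJ := (hf.joinN hg).joinN hk
  rw [hJ.entropy_eq_integral, hk.entropy_eq_integral, (hf.joinN hk).entropy_eq_integral,
    (hg.joinN hk).entropy_eq_integral]
  set J : X → ℕ × ℕ × ℕ := fun x => (f x, g x, k x) with hJdef
  set T := hf.2.toFinset ×ˢ hg.2.toFinset ×ˢ hk.2.toFinset with hTdef
  have hT : ∀ x, J x ∈ T := fun x => by simp [hJdef, hTdef]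
  have hJpre : ∀ z, J ⁻¹' {z} = f ⁻¹' {z.1} ∩ g ⁻¹' {z.2.1} ∩ k ⁻¹' {z.2.2} := fun z => by
    ext x
    simp [hJdef, Prod.ext_iff, and_assoc]
  have hJm : ∀ z, MeasurableSet (J ⁻¹' {z}) := fun z => by
    rw [hJpre]
    exact ((hf.measurableSet_preimage _).inter (hg.measurableSet_preimage _)).inter
      (hk.measurableSet_preimage _)
  have hint : ∀ φ : ℕ × ℕ × ℕ → ℝ, Integrable (fun x => φ (J x)) μ :=
    fun φ => integrable_comp_of_mem_finset hT hJm φ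
  set pJ : ℕ × ℕ × ℕ → ℝ := fun z => μ.real (f ⁻¹' {z.1} ∩ g ⁻¹' {z.2.1} ∩ k ⁻¹' {z.2.2})
  set pk : ℕ × ℕ × ℕ → ℝ := fun z => μ.real (k ⁻¹' {z.2.2})
  set pf : ℕ × ℕ × ℕ → ℝ := fun z => μ.real (f ⁻¹' {z.1} ∩ k ⁻¹' {z.2.2})
  set pg : ℕ × ℕ × ℕ → ℝ := fun z => μ.real (g ⁻¹' {z.2.1} ∩ k ⁻¹' {z.2.2})
  simp only [joinN_preimage_singleton]
  change ∫ x, -log (pJ (J x)) ∂μ + ∫ x, -log (pk (J x)) ∂μ ≤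
    ∫ x, -log (pf (J x)) ∂μ + ∫ x, -log (pg (J x)) ∂μ
  rw [← integral_add (hint fun z => -log (pJ z)) (hint fun z => -log (pk z)),
    ← integral_add (hint fun z => -log (pf z)) (hint fun z => -log (pg z)), ← sub_nonpos,
    ← integral_sub (hint fun z => -log (pJ z) + -log (pk z))
      (hint fun z => -log (pf z) + -log (pg z))]
  have hratio : ∫ x, pf (J x) * pg (J x) / (pk (J x) * pJ (J x)) ∂μ ≤ 1 := by
    rw [integral_comp_of_mem_finset hT hJm fun z => pf z * pg z / (pk z * pJ z)]
    refine le_trans (Finset.sum_le_sum fun z _ => ?_) (hf.sum_ratio_le_one hg hk (μ := μ))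
    rw [hJpre]
    change pJ z * (pf z * pg z / (pk z * pJ z)) ≤ pf z * pg z / pk z
    have hf0 : 0 ≤ pf z := measureReal_nonneg
    have hg0 : 0 ≤ pg z := measureReal_nonneg
    have hk0 : 0 ≤ pk z := measureReal_nonneg
    rcases eq_or_ne (pJ z) 0 with h0 | h0
    · rw [h0, zero_mul]
      positivity
    · rw [← div_div, mul_div_cancel₀ _ h0]
  calc ∫ x, (-log (pJ (J x)) + -log (pk (J x)) - (-log (pf (J x)) + -log (pg (J x)))) ∂μ
      ≤ ∫ x, (pf (J x) * pg (J x) / (pk (J x) * pJ (J x)) - 1) ∂μ := by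
        refine integral_mono_ae
          (hint fun z => -log (pJ z) + -log (pk z) - (-log (pf z) + -log (pg z)))
          (hint fun z => pf z * pg z / (pk z * pJ z) - 1) ?_
        filter_upwards [ae_measureReal_preimage_pos (μ := μ) (Bowen.joinN (Bowen.joinN f g) k)] with x hx
        simp only [joinN_preimage_singleton] at hx
        have hJx : 0 < pJ (J x) := hx
        have hkx : 0 < pk (J x) := hJx.trans_le (measureReal_mono Set.inter_subset_right)
        have hfx : 0 < pf (J x) := hJx.trans_le
          (measureReal_mono (Set.inter_subset_inter_left _ Set.inter_subset_left))
        have hgx : 0 < pg (J x) := hJx.trans_le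
          (measureReal_mono (Set.inter_subset_inter_left _ Set.inter_subset_right))
        have h := log_le_sub_one_of_pos (div_pos (mul_pos hfx hgx) (mul_pos hkx hJx))
        rw [log_div (by positivity) (by positivity), log_mul hfx.ne' hgx.ne',
          log_mul hkx.ne' hJx.ne'] at h
        linarith
    _ ≤ 0 := by
        rw [integral_sub (hint fun z => pf z * pg z / (pk z * pJ z)) (integrable_const _)]
        simpa using hratio

lemma IsAEFinPart.entropy_submodular (hf : IsAEFinPart μ f) (hg : IsAEFinPart μ g)
    (hk : IsAEFinPart μ k) :
    entropy μ (Bowen.joinN (Bowen.joinN f g) k) + entropy μ k ≤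
      entropy μ (Bowen.joinN f k) + entropy μ (Bowen.joinN g k) := by
  obtain ⟨f', hf', hff'⟩ := hf
  obtain ⟨g', hg', hgg'⟩ := hg
  obtain ⟨k', hkfin, hkk'⟩ := hk
  rw [entropy_congr_ae (joinN_congr_ae (joinN_congr_ae hff' hgg') hkk'), entropy_congr_ae hkk',
    entropy_congr_ae (joinN_congr_ae hff' hkk'), entropy_congr_ae (joinN_congr_ae hgg' hkk')]
  exact hf'.entropy_submodular hg' hkfin

/-- If `f` refines `g`, then `H(f | g ∨ k) ≤ H(f | g)`. -/
lemma IsAEFinPart.entropy_joinN_add_le (hf : IsAEFinPart μ f) (hk : IsAEFinPart μ k)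
    (h : RefinesI μ f g) :
    entropy μ (Bowen.joinN f k) + entropy μ g ≤ entropy μ f + entropy μ (Bowen.joinN g k) := by
  have hg := hf.of_refinesI h
  have h₁ : entropy μ (Bowen.joinN (Bowen.joinN f k) g) = entropy μ (Bowen.joinN f k) :=
    ((hf.joinN hk).joinN hg).entropy_eq ⟨refinesI_joinN_left _ _,
      (RefinesI.refl _).joinN ((refinesI_joinN_left f k).trans h)⟩
  have h₂ : entropy μ (Bowen.joinN f g) = entropy μ f :=
    (hf.joinN hg).entropy_eq ⟨refinesI_joinN_left _ _, (RefinesI.refl _).joinN h⟩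
  have h₃ := (hk.joinN hg).entropy_eq (samePart_joinN_comm k g)
  have := hf.entropy_submodular hk hg
  rwa [h₁, h₂, h₃] at this

end Entropy

section Splitting

variable {X : Type*} [MeasurableSpace X] {μ : Measure X}
  {G : Type*} [Group G] [MulAction G X] {σ α β : X → ℕ}

lemma SimpleSplit.refinesI {S : Finset G} (h : SimpleSplit μ S σ α) : RefinesI μ σ α := by
  obtain ⟨s, -, β, -, h, -⟩ := h
  exact h.trans (refinesI_joinN_left _ _)

lemma SimpleSplit.isAEFinPart (hmp : ∀ g : G, MeasurePreserving (fun x : X => g • x) μ μ)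
    {S : Finset G} (h : SimpleSplit μ S σ α) (hα : IsAEFinPart μ α) : IsAEFinPart μ σ := by
  obtain ⟨s, -, β, hβ, -, h⟩ := h
  exact (hα.joinN ((hα.of_refinesI hβ).smulPart hmp s)).of_refinesI h

lemma refinesI_of_samePart_joinN (hmp : ∀ g : G, MeasurePreserving (fun x : X => g • x) μ μ)
    {s : G} (hβ : RefinesI μ α β) (h : SamePart μ σ (joinN α (smulPart s β))) :
    RefinesI μ (joinN α (smulPart s α)) σ :=
  RefinesI.trans ((refinesI_joinN_left _ _).joinN
    ((refinesI_joinN_right _ _).trans (hβ.smulPart hmp s))) h.2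

lemma IsSplitting.isAEFinPart (hmp : ∀ g : G, MeasurePreserving (fun x : X => g • x) μ μ)
    {S : Finset G} (h : IsSplitting μ S σ α) (hα : IsAEFinPart μ α) : IsAEFinPart μ σ := by
  induction h with
  | refl => exact hα
  | tail _ hs ih => exact SimpleSplit.isAEFinPart hmp hs ih

variable [IsProbabilityMeasure μ]

lemma entropy_joinN_smulPart_le_add_two_mul
    (hmp : ∀ g : G, MeasurePreserving (fun x : X => g • x) μ μ) (hσ : IsAEFinPart μ σ)
    (h : RefinesI μ σ α) (s : G) :
    entropy μ (joinN σ (smulPart s σ)) ≤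
      entropy μ (joinN α (smulPart s α)) + 2 * (entropy μ σ - entropy μ α) := by
  have hα := hσ.of_refinesI h
  have hsσ := hσ.smulPart hmp s
  have hsα := hα.smulPart hmp s
  have h₁ := hσ.entropy_joinN_add_le hsα h
  have h₂ := hsσ.entropy_joinN_add_le hσ (h.smulPart hmp s)
  rw [hσ.entropy_smulPart hmp, hα.entropy_smulPart hmp,
    (hsσ.joinN hσ).entropy_eq (samePart_joinN_comm _ _),
    (hsα.joinN hσ).entropy_eq (samePart_joinN_comm _ _)] at h₂
  linarith

lemma entropy_joinN_smulPart_le_add_of_right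
    (hmp : ∀ g : G, MeasurePreserving (fun x : X => g • x) μ μ) (hσ : IsAEFinPart μ σ)
    (h : RefinesI μ σ α) (s : G) (hs : RefinesI μ (joinN α (smulPart s α)) σ) :
    entropy μ (joinN σ (smulPart s σ)) ≤
      entropy μ (joinN α (smulPart s α)) + (entropy μ σ - entropy μ α) := by
  have hα := hσ.of_refinesI h
  have hsσ := hσ.smulPart hmp s
  have hsα := hα.smulPart hmp s
  have h₁ : entropy μ (joinN σ (smulPart s α)) = entropy μ (joinN α (smulPart s α)) :=
    (hσ.joinN hsα).entropy_eq
      ⟨((refinesI_joinN_left _ _).trans h).joinN (refinesI_joinN_right _ _),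
        hs.joinN (refinesI_joinN_right _ _)⟩
  have h₂ := hsσ.entropy_joinN_add_le hσ (h.smulPart hmp s)
  rw [hσ.entropy_smulPart hmp, hα.entropy_smulPart hmp,
    (hsσ.joinN hσ).entropy_eq (samePart_joinN_comm _ _),
    (hsα.joinN hσ).entropy_eq (samePart_joinN_comm _ _)] at h₂
  linarith

lemma entropy_joinN_smulPart_inv (hmp : ∀ g : G, MeasurePreserving (fun x : X => g • x) μ μ)
    (hα : IsAEFinPart μ α) (s : G) :
    entropy μ (joinN α (smulPart s⁻¹ α)) = entropy μ (joinN α (smulPart s α)) := by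
  rw [← (hα.joinN (hα.smulPart hmp s⁻¹)).entropy_smulPart hmp s]
  change entropy μ (joinN (smulPart s α) (smulPart s (smulPart s⁻¹ α))) = _
  rw [smulPart_smulPart, mul_inv_cancel, smulPart_one]
  exact ((hα.smulPart hmp s).joinN hα).entropy_eq (samePart_joinN_comm _ _)

lemma Ffun_le_of_simpleSplit {r : ℕ} [MulAction (FreeGroup (Fin r)) X]
    (hmp : ∀ g : FreeGroup (Fin r), MeasurePreserving (fun x : X => g • x) μ μ)
    (hα : IsAEFinPart μ α) (h : SimpleSplit μ (genS r) σ α) : Ffun r μ σ ≤ Ffun r μ α := by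
  have hσ := h.isAEFinPart hmp hα
  have href := h.refinesI
  obtain ⟨s, hs, β, hβ, hsame⟩ := h
  have hR := refinesI_of_samePart_joinN hmp hβ hsame
  set D := entropy μ σ - entropy μ α with hD
  obtain ⟨j, hj⟩ : ∃ j : Fin r,
      entropy μ (joinN σ (smulPart (FreeGroup.of j) σ)) ≤
        entropy μ (joinN α (smulPart (FreeGroup.of j) α)) + D := by
    have hle := entropy_joinN_smulPart_le_add_of_right hmp hσ href s hR
    simp only [genS, Finset.mem_union, Finset.mem_image, Finset.mem_univ, true_and] at hs
    rcases hs with ⟨j, rfl⟩ | ⟨j, rfl⟩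
    · exact ⟨j, hle⟩
    · rw [entropy_joinN_smulPart_inv hmp hσ, entropy_joinN_smulPart_inv hmp hα] at hle
      exact ⟨j, hle⟩
  have hsum : ∑ i : Fin r, entropy μ (joinN σ (smulPart (FreeGroup.of i) σ)) ≤
      ∑ i : Fin r, (entropy μ (joinN α (smulPart (FreeGroup.of i) α)) +
        (2 * D - if i = j then D else 0)) := by
    refine Finset.sum_le_sum fun i _ => ?_
    split_ifs with hij
    · subst hij
      linarith
    · simpa using entropy_joinN_smulPart_le_add_two_mul hmp hσ href (FreeGroup.of i)
  simp only [Finset.sum_add_distrib, Finset.sum_sub_distrib, Finset.sum_const, Finset.card_univ,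
    Fintype.card_fin, nsmul_eq_mul, Finset.sum_ite_eq', Finset.mem_univ, if_true] at hsum
  unfold Ffun
  have hexp : (1 - 2 * (r : ℝ)) * entropy μ σ = (1 - 2 * (r : ℝ)) * entropy μ α +
      (D - r * (2 * D)) := by
    rw [hD]
    ring
  linarith

end Splitting

end Bowen

/-- Proposition 5.1: for the free group of rank `r` with
`F(α) = (1-2r)H(α) + ∑ᵢ H(α ∨ sᵢα)`, if `σ` is a splitting of `α` then `F(σ) ≤ F(α)`. -/
theorem Ffun_mono_splitting {X : Type*} [MeasurableSpace X] {r : ℕ}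
    [MulAction (FreeGroup (Fin r)) X] (μ : Measure X) [IsProbabilityMeasure μ]
    (hmp : ∀ g : FreeGroup (Fin r), MeasurePreserving (fun x : X => g • x) μ μ)
    (σ α : X → ℕ) (hα : IsFinPart α) (hσ : IsFinPart σ)
    (hsplit : IsSplitting μ (genS r) σ α) :
    Ffun r μ σ ≤ Ffun r μ α := by
  clear hσ
  have hα' : IsAEFinPart μ α := hα.isAEFinPart
  induction hsplit with
  | refl => exact le_rfl
  | tail h hs ih => exact (Ffun_le_of_simpleSplit hmp (IsSplitting.isAEFinPart hmp h hα') hs).trans ih
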